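/- arXiv:2206.11397 — 7 statements merged into one kernel-verified Lean document; each statement's English description precedes it below -/
import Mathlib

section
/- Structural lemma for the first-stage optimizer: Let D₁ and S be finite sets, E₁ ⊆ D₁ × S an edge set, w : S → ℝ with w_j > 0 for all j, and for each j ∈ S let f_j : [0,1] → [0,1] be continuous and monotone nondecreasing. Let x̄ maximize Φ(x) = Σ_{j∈S} w_j ( x_j − ∫₀^{x_j} f_j(t) dt ) over all first-stage fractional matchings x (where x_j := Σ_{i∈D₁} x_{ij} and x_i := Σ_{j∈S} x_{ij}). Call j ∈ S filled if x̄_j = 1 or f_j(x̄_j) = 1, and unfilled otherwise. Then for every i ∈ D₁: (1) if some j with (i,j) ∈ E₁ is unfilled, then x̄_i = 1; and (2) for every unfilled j with (i,j) ∈ E₁ and every k ∈ S with x̄_{ik} > 0, one has w_j (1 − f_j(x̄_j)) ≤ w_k (1 − f_k(x̄_k)). -/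
open Finset

/-- A first-stage fractional matching on `(D₁, S, E₁)`: nonnegative, supported on
`E₁`, with all row sums and column sums at most `1`. -/
def IsFracMatching {D₁ S : Type*} [Fintype D₁] [Fintype S]
    (E₁ : Finset (D₁ × S)) (x : D₁ → S → ℝ) : Prop :=
  (∀ i j, 0 ≤ x i j) ∧ (∀ i j, (i, j) ∉ E₁ → x i j = 0) ∧
    (∀ i, ∑ j, x i j ≤ 1) ∧ (∀ j, ∑ i, x i j ≤ 1)

/-- The first-stage objective `Φ(x) = Σ_j w_j (x_j − ∫₀^{x_j} f_j(t) dt)`,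
where `x_j = Σ_i x_{ij}`. -/
noncomputable def firstStageObj {D₁ S : Type*} [Fintype D₁] [Fintype S]
    (w : S → ℝ) (f : S → ℝ → ℝ) (x : D₁ → S → ℝ) : ℝ :=
  ∑ j, w j * ((∑ i, x i j) - ∫ t in (0:ℝ)..(∑ i, x i j), f j t)

open Topology in
/-- A bound `a ≤ M` persists along `a + ε * b` for small `ε > 0`, provided it is strict
whenever `b` is positive. -/
lemma eventually_add_mul_le {a b M : ℝ} (h : a ≤ M) (hlt : 0 < b → a < M) :
    ∀ᶠ ε in 𝓝[>] (0 : ℝ), a + ε * b ≤ M := by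
  rcases le_or_gt b 0 with hb | hb
  · filter_upwards [self_mem_nhdsWithin] with ε hε
    nlinarith [mul_nonneg (le_of_lt (Set.mem_Ioi.mp hε)) (neg_nonneg.mpr hb)]
  · have ht : Filter.Tendsto (fun ε : ℝ => a + ε * b) (𝓝[>] 0) (𝓝 a) := by
      have : Filter.Tendsto (fun ε : ℝ => a + ε * b) (𝓝 0) (𝓝 (a + 0 * b)) :=
        Continuous.tendsto (by fun_prop) 0
      simpa using this.mono_left nhdsWithin_le_nhds
    exact (ht.eventually (gt_mem_nhds (hlt hb))).mono fun ε hε => le_of_lt hε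

/-- The oriented integral of a monotone function is at most the increment times its value
at the upper endpoint, whatever the order of the endpoints. -/
lemma intervalIntegral_le_sub_mul_of_monotoneOn {g : ℝ → ℝ} {s : Set ℝ} [s.OrdConnected]
    (hg : MonotoneOn g s) {a b : ℝ} (ha : a ∈ s) (hb : b ∈ s) :
    ∫ t in a..b, g t ≤ (b - a) * g b := by
  have hsub : Set.uIcc a b ⊆ s := Set.OrdConnected.uIcc_subset ‹_› ha hb
  have hint : IntervalIntegrable g MeasureTheory.volume a b :=
    (hg.mono hsub).intervalIntegrable
  rcases le_total a b with hab | hab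
  · rw [Set.uIcc_of_le hab] at hsub
    have := intervalIntegral.integral_mono_on hab hint intervalIntegrable_const
      (fun t ht => hg (hsub ht) hb ht.2)
    simpa using this
  · rw [Set.uIcc_of_ge hab] at hsub
    have := intervalIntegral.integral_mono_on hab intervalIntegrable_const hint.symm
      (fun t ht => hg hb (hsub ht) ht.1)
    rw [intervalIntegral.integral_symm]
    simp only [intervalIntegral.integral_const, smul_eq_mul] at this
    linarith

section Perturbation

variable {D₁ S : Type*} [Fintype D₁] [Fintype S]

lemma IsFracMatching.col_mem_Icc {E₁ : Finset (D₁ × S)} {x : D₁ → S → ℝ}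
    (hx : IsFracMatching E₁ x) (j : S) : ∑ i, x i j ∈ Set.Icc (0 : ℝ) 1 :=
  ⟨Finset.sum_nonneg fun i _ => hx.1 i j, hx.2.2.2 j⟩

open Topology in
/-- Moving row `i` of a fractional matching in a direction `v` that violates no tight
constraint gives a fractional matching, for small step sizes. -/
lemma IsFracMatching.eventually_add_row [DecidableEq D₁] {E₁ : Finset (D₁ × S)}
    {x : D₁ → S → ℝ} (hx : IsFracMatching E₁ x) (i : D₁) (v : S → ℝ)
    (hE : ∀ j, v j ≠ 0 → (i, j) ∈ E₁) (hneg : ∀ j, v j < 0 → 0 < x i j)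
    (hcol : ∀ j, 0 < v j → ∑ i', x i' j < 1) (hrow : 0 < ∑ j, v j → ∑ j, x i j < 1) :
    ∀ᶠ ε in 𝓝[>] (0 : ℝ),
      IsFracMatching E₁ (fun i' j => x i' j + if i' = i then ε * v j else 0) := by
  have h1 : ∀ᶠ ε in 𝓝[>] (0 : ℝ), ∀ j, -x i j + ε * -v j ≤ 0 :=
    Filter.eventually_all.2 fun j => eventually_add_mul_le (by linarith [hx.1 i j])
      fun h => by linarith [hneg j (by linarith)]
  have h2 : ∀ᶠ ε in 𝓝[>] (0 : ℝ), ∀ j, (∑ i', x i' j) + ε * v j ≤ 1 :=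
    Filter.eventually_all.2 fun j => eventually_add_mul_le (hx.2.2.2 j) (hcol j)
  filter_upwards [h1, h2, eventually_add_mul_le (hx.2.2.1 i) hrow] with ε h1 h2 h3
  refine ⟨fun i' j => ?_, fun i' j hij => ?_, fun i' => ?_, fun j => ?_⟩
  · beta_reduce
    split_ifs with h
    · subst h; linarith [h1 j]
    · simpa using hx.1 i' j
  · beta_reduce
    split_ifs with h
    · subst h
      have hv : v j = 0 := by_contra fun hv => hij (hE j hv)
      simp [hv, hx.2.1 _ _ hij]
    · simpa using hx.2.1 i' j hij
  · beta_reduce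
    split_ifs with h
    · subst h; simpa [Finset.sum_add_distrib, Finset.mul_sum] using h3
    · simpa using hx.2.2.1 i'
  · simpa [Finset.sum_add_distrib] using h2 j

/-- The objective is bounded below along column increments by its linearization at the
new point. -/
lemma sum_mul_le_firstStageObj_sub {E₁ : Finset (D₁ × S)} {w : S → ℝ} (hw : ∀ j, 0 < w j)
    {f : S → ℝ → ℝ} (hf_mono : ∀ j, MonotoneOn (f j) (Set.Icc 0 1))
    {x y : D₁ → S → ℝ} (hx : IsFracMatching E₁ x) (hy : IsFracMatching E₁ y) :
    ∑ j, w j * (((∑ i, y i j) - ∑ i, x i j) * (1 - f j (∑ i, y i j))) ≤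
      firstStageObj w f y - firstStageObj w f x := by
  rw [firstStageObj, firstStageObj, ← Finset.sum_sub_distrib]
  refine Finset.sum_le_sum fun j _ => ?_
  rw [← mul_sub]
  refine mul_le_mul_of_nonneg_left ?_ (hw j).le
  have hint : ∀ c ∈ Set.Icc (0 : ℝ) 1,
      IntervalIntegrable (f j) MeasureTheory.volume 0 c := fun c hc =>
    ((hf_mono j).mono (Set.OrdConnected.uIcc_subset Set.ordConnected_Icc
      (by simp) hc)).intervalIntegrable
  have hsub := intervalIntegral.integral_interval_sub_left
    (hint _ (hy.col_mem_Icc j)) (hint _ (hx.col_mem_Icc j))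
  have hle := intervalIntegral_le_sub_mul_of_monotoneOn (hf_mono j)
    (hx.col_mem_Icc j) (hy.col_mem_Icc j)
  linarith

open Topology in
/-- First-order optimality condition for a maximizer of the first-stage objective, in a
feasible direction `v` supported on row `i`. -/
lemma sum_mul_one_sub_nonpos_of_isMax {E₁ : Finset (D₁ × S)} {w : S → ℝ}
    (hw : ∀ j, 0 < w j) {f : S → ℝ → ℝ}
    (hf_cont : ∀ j, ContinuousOn (f j) (Set.Icc 0 1))
    (hf_mono : ∀ j, MonotoneOn (f j) (Set.Icc 0 1))
    {x : D₁ → S → ℝ} (hx : IsFracMatching E₁ x)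
    (hopt : ∀ y, IsFracMatching E₁ y → firstStageObj w f y ≤ firstStageObj w f x)
    (i : D₁) (v : S → ℝ)
    (hE : ∀ j, v j ≠ 0 → (i, j) ∈ E₁) (hneg : ∀ j, v j < 0 → 0 < x i j)
    (hcol : ∀ j, 0 < v j → ∑ i', x i' j < 1) (hrow : 0 < ∑ j, v j → ∑ j, x i j < 1) :
    ∑ j, w j * (v j * (1 - f j (∑ i', x i' j))) ≤ 0 := by
  classical
  have hfeas := hx.eventually_add_row i v hE hneg hcol hrow
  have hsum : ∀ (ε : ℝ) (j : S), ∑ i', (x i' j + if i' = i then ε * v j else 0) =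
      (∑ i', x i' j) + ε * v j := fun ε j => by simp [Finset.sum_add_distrib]
  have hlim : Filter.Tendsto
      (fun ε : ℝ => ∑ j, w j * (v j * (1 - f j ((∑ i', x i' j) + ε * v j)))) (𝓝[>] 0)
      (𝓝 (∑ j, w j * (v j * (1 - f j (∑ i', x i' j))))) := by
    refine tendsto_finsetSum _ fun j _ => ((Filter.Tendsto.const_sub 1 ?_).const_mul _).const_mul _
    refine (hf_cont j _ (hx.col_mem_Icc j)).tendsto.comp
      (tendsto_nhdsWithin_iff.2 ⟨?_, ?_⟩)
    · have : Filter.Tendsto (fun ε : ℝ => (∑ i', x i' j) + ε * v j) (𝓝 0)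
          (𝓝 ((∑ i', x i' j) + 0 * v j)) := Continuous.tendsto (by fun_prop) 0
      simpa using this.mono_left nhdsWithin_le_nhds
    · filter_upwards [hfeas] with ε hε
      simpa only [hsum] using hε.col_mem_Icc j
  refine le_of_tendsto hlim ?_
  filter_upwards [hfeas, self_mem_nhdsWithin] with ε hε hpos
  have h := (sum_mul_le_firstStageObj_sub hw hf_mono hx hε).trans
    (sub_nonpos.2 (hopt _ hε))
  simp only [hsum, add_sub_cancel_left] at h
  refine nonpos_of_mul_nonpos_right (a := ε) ?_ hpos
  rw [Finset.mul_sum]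
  refine (Finset.sum_congr rfl fun j _ => ?_).trans_le h
  ring

end Perturbation

/-- Structural lemma for the first-stage optimizer: if `x̄` maximizes
`Φ(x) = Σ_j w_j (x_j − ∫₀^{x_j} f_j(t) dt)` over first-stage fractional matchings,
where each `f_j : [0,1] → [0,1]` is continuous and nondecreasing and `w_j > 0`,
then for every online vertex `i`: (1) if `i` has an unfilled neighbor (a `j` with
`(i,j) ∈ E₁`, `x̄_j ≠ 1` and `f_j(x̄_j) ≠ 1`), then `x̄_i = 1`; and (2) for every
unfilled neighbor `j` of `i` and every `k` with `x̄_{ik} > 0`,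
`w_j (1 − f_j(x̄_j)) ≤ w_k (1 − f_k(x̄_k))`. -/
theorem first_stage_structural_lemma
    {D₁ S : Type*} [Fintype D₁] [Fintype S]
    (E₁ : Finset (D₁ × S)) (w : S → ℝ) (hw : ∀ j, 0 < w j)
    (f : S → ℝ → ℝ)
    (hf_cont : ∀ j, ContinuousOn (f j) (Set.Icc 0 1))
    (hf_mono : ∀ j, MonotoneOn (f j) (Set.Icc 0 1))
    (hf_range : ∀ j, ∀ t ∈ Set.Icc (0:ℝ) 1, f j t ∈ Set.Icc (0:ℝ) 1)
    (xbar : D₁ → S → ℝ)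
    (hxbar : IsFracMatching E₁ xbar)
    (hopt : ∀ x : D₁ → S → ℝ, IsFracMatching E₁ x →
      firstStageObj w f x ≤ firstStageObj w f xbar) :
    ∀ i : D₁,
      ((∃ j : S, (i, j) ∈ E₁ ∧ (∑ i', xbar i' j) ≠ 1 ∧ f j (∑ i', xbar i' j) ≠ 1) →
        ∑ j, xbar i j = 1) ∧
      (∀ j : S, (i, j) ∈ E₁ → (∑ i', xbar i' j) ≠ 1 → f j (∑ i', xbar i' j) ≠ 1 →
        ∀ k : S, 0 < xbar i k →
          w j * (1 - f j (∑ i', xbar i' j)) ≤ w k * (1 - f k (∑ i', xbar i' k))) := by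
  classical
  intro i
  have hlt : ∀ j, (∑ i', xbar i' j) ≠ 1 → ∑ i', xbar i' j < 1 := fun j h =>
    lt_of_le_of_ne (hxbar.2.2.2 j) h
  refine ⟨?_, ?_⟩
  · rintro ⟨j, hj, hj1, hfj⟩
    by_contra hrow
    have h := sum_mul_one_sub_nonpos_of_isMax hw hf_cont hf_mono hxbar hopt i
      (Pi.single j 1)
      (fun s hs => by
        obtain rfl : s = j := by_contra fun hsj => hs (Pi.single_eq_of_ne hsj _)
        exact hj)
      (fun s hs => by
        have : (0 : ℝ) ≤ (Pi.single j 1 : S → ℝ) s := by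
          rw [Pi.single_apply]; split_ifs <;> norm_num
        linarith)
      (fun s hs => by
        obtain rfl : s = j := by_contra fun hsj => hs.ne' (Pi.single_eq_of_ne hsj _)
        exact hlt s hj1)
      (fun _ => lt_of_le_of_ne (hxbar.2.2.1 i) hrow)
    simp only [Pi.single_apply, ite_mul, one_mul, zero_mul, mul_ite, mul_zero,
      Finset.sum_ite_eq', Finset.mem_univ, if_true] at h
    have hf1 := lt_of_le_of_ne (hf_range j _ (hxbar.col_mem_Icc j)).2 hfj
    exact absurd h (not_le.2 (mul_pos (hw j) (sub_pos.2 hf1)))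
  · intro j hj hj1 _ k hk
    rcases eq_or_ne j k with rfl | hjk
    · exact le_rfl
    have hkE : (i, k) ∈ E₁ := by_contra fun h => hk.ne' (hxbar.2.1 i k h)
    have h := sum_mul_one_sub_nonpos_of_isMax hw hf_cont hf_mono hxbar hopt i
      (fun s => (if s = j then 1 else 0) - if s = k then 1 else 0)
      (fun s hs => by
        by_cases hsj : s = j
        · rwa [hsj]
        by_cases hsk : s = k
        · rwa [hsk]
        simp [hsj, hsk] at hs)
      (fun s hs => by
        by_cases hsk : s = k
        · rwa [hsk]
        · simp only [hsk, if_false] at hs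
          split_ifs at hs <;> norm_num at hs)
      (fun s hs => by
        by_cases hsj : s = j
        · rw [hsj]; exact hlt j hj1
        · simp only [hsj, if_false] at hs
          split_ifs at hs <;> norm_num at hs)
      (fun hs => by simp at hs)
    simp only [sub_mul, mul_sub, ite_mul, one_mul, zero_mul, mul_ite, mul_zero, mul_one,
      Finset.sum_sub_distrib, Finset.sum_ite_eq', Finset.mem_univ, if_true] at h
    linarith
end

section
/- Robustness theorem (Theorem 4.1): Let D₁, D₂, S be finite sets, E₁ ⊆ D₁ × S, E₂ ⊆ D₂ × S, w : S → ℝ with w_j ≥ 0, and let R ∈ [0, 3/4]. For each j ∈ S let f_j : [0,1] → [0,1] be continuous, monotone nondecreasing, and satisfy 1 − (1−R)/x ≤ f_j(x) for all x ∈ (0,1] and f_j(x) ≤ (1−R)/(1−x) for all x ∈ [0,1). Let x̄ maximize Σ_{j∈S} w_j ( x_j − ∫₀^{x_j} f_j(t) dt ) over all first-stage fractional matchings x on (D₁, S, E₁), and let ȳ maximize Σ_{j∈S} w_j y_j over all y : D₂ × S → ℝ with y_{ij} ≥ 0, y_{ij} = 0 for (i,j) ∉ E₂, Σ_{j} y_{ij}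 ≤ 1 for every i ∈ D₂, and Σ_{i} y_{ij} ≤ 1 − x̄_j for every j ∈ S. Then Σ_{j∈S} w_j (x̄_j + ȳ_j) ≥ R · OPT, where OPT is the supremum of Σ_{j∈S} w_j z_j over all fractional matchings z on the combined bipartite graph with online vertex set D₁ ⊔ D₂ and edge set E₁ ∪ E₂. -/
open Finset

/-- A feasible second-stage fractional matching given first-stage column sums
`x̄_j`: nonnegative, supported on `E₂`, row sums at most `1`, and column sums at
most the residual capacity `1 − x̄_j`. -/
def IsSecondStageFeasible {D₁ D₂ S : Type*} [Fintype D₁] [Fintype D₂] [Fintype S]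
    (E₂ : Finset (D₂ × S)) (xbar : D₁ → S → ℝ) (y : D₂ → S → ℝ) : Prop :=
  (∀ i j, 0 ≤ y i j) ∧ (∀ i j, (i, j) ∉ E₂ → y i j = 0) ∧
    (∀ i, ∑ j, y i j ≤ 1) ∧ (∀ j, ∑ i, y i j ≤ 1 - ∑ i, xbar i j)

/-- The set of values attainable by fractional matchings on the combined bipartite
graph with online vertex set `D₁ ⊔ D₂` and edge set `E₁ ∪ E₂`; its supremum is
`OPT`. -/
def offlineValues {D₁ D₂ S : Type*} [Fintype D₁] [Fintype D₂] [Fintype S]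
    (E₁ : Finset (D₁ × S)) (E₂ : Finset (D₂ × S)) (w : S → ℝ) : Set ℝ :=
  {v | ∃ z : (D₁ ⊕ D₂) → S → ℝ,
    (∀ i j, 0 ≤ z i j) ∧
    (∀ i j, (i, j) ∉ E₁ → z (Sum.inl i) j = 0) ∧
    (∀ i j, (i, j) ∉ E₂ → z (Sum.inr i) j = 0) ∧
    (∀ i, ∑ j, z i j ≤ 1) ∧ (∀ j, ∑ i, z i j ≤ 1) ∧
    v = ∑ j, w j * ∑ i, z i j}

/-- For a monotone integrand, the oriented integral from `a` to `b` is at most `(b - a) * g b`. -/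
theorem integral_le_sub_mul_of_monotoneOn {g : ℝ → ℝ} {s : Set ℝ} (hs : s.OrdConnected)
    (hg : MonotoneOn g s) {a b : ℝ} (ha : a ∈ s) (hb : b ∈ s) :
    ∫ t in a..b, g t ≤ (b - a) * g b := by
  have hint : IntervalIntegrable g MeasureTheory.volume a b :=
    (hg.mono (hs.uIcc_subset ha hb)).intervalIntegrable
  rcases le_total a b with h | h
  · calc ∫ t in a..b, g t ≤ ∫ _ in a..b, g b :=
          intervalIntegral.integral_mono_on h hint intervalIntegrable_const
            fun t ht => hg (hs.out ha hb ht) hb ht.2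
      _ = (b - a) * g b := by simp
  · have hle : ∫ _ in b..a, g b ≤ ∫ t in b..a, g t :=
      intervalIntegral.integral_mono_on h intervalIntegrable_const hint.symm
        fun t ht => hg hb (hs.out hb ha ht) ht.1
    rw [intervalIntegral.integral_const, smul_eq_mul] at hle
    rw [intervalIntegral.integral_symm b a]
    linarith

namespace IsFracMatching

variable {D S : Type*} [Fintype D] [Fintype S] {E : Finset (D × S)} {x x' : D → S → ℝ}

theorem colSum_mem_Icc (hx : IsFracMatching E x) (j : S) :
    ∑ i, x i j ∈ Set.Icc (0 : ℝ) 1 :=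
  ⟨sum_nonneg fun i _ => hx.1 i j, hx.2.2.2 j⟩

theorem convexCombination (hx : IsFracMatching E x) (hx' : IsFracMatching E x') {ε : ℝ}
    (h0 : 0 ≤ ε) (h1 : ε ≤ 1) :
    IsFracMatching E fun i j => (1 - ε) * x i j + ε * x' i j := by
  have h1' : 0 ≤ 1 - ε := sub_nonneg.2 h1
  refine ⟨fun i j => ?_, fun i j hij => ?_, fun i => ?_, fun j => ?_⟩
  · have := hx.1 i j
    have := hx'.1 i j
    positivity
  · simp [hx.2.1 i j hij, hx'.2.1 i j hij]
  · rw [sum_add_distrib, ← mul_sum, ← mul_sum]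
    nlinarith [hx.2.2.1 i, hx'.2.2.1 i]
  · rw [sum_add_distrib, ← mul_sum, ← mul_sum]
    nlinarith [hx.2.2.2 j, hx'.2.2.2 j]

/-- First-order optimality condition for a maximizer of the first-stage objective. -/
theorem sum_gradient_mul_sub_nonpos {w : S → ℝ} (hw : ∀ j, 0 ≤ w j) {f : S → ℝ → ℝ}
    (hf_cont : ∀ j, ContinuousOn (f j) (Set.Icc 0 1))
    (hf_mono : ∀ j, MonotoneOn (f j) (Set.Icc 0 1))
    (hx : IsFracMatching E x)
    (hopt : ∀ z, IsFracMatching E z → firstStageObj w f z ≤ firstStageObj w f x)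
    (hx' : IsFracMatching E x') :
    ∑ j, w j * ((1 - f j (∑ i, x i j)) * (∑ i, x' i j - ∑ i, x i j)) ≤ 0 := by
  set a : S → ℝ := fun j => ∑ i, x i j
  set b : S → ℝ := fun j => ∑ i, x' i j
  have ha : ∀ j, a j ∈ Set.Icc (0 : ℝ) 1 := hx.colSum_mem_Icc
  have hcol (ε : ℝ) (j : S) :
      ∑ i, ((1 - ε) * x i j + ε * x' i j) = a j + ε * (b j - a j) := by
    rw [sum_add_distrib, ← mul_sum, ← mul_sum]
    ring
  have hmem {ε : ℝ} (hε : ε ∈ Set.Ioc (0 : ℝ) 1) (j : S) :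
      a j + ε * (b j - a j) ∈ Set.Icc (0 : ℝ) 1 :=
    hcol ε j ▸ (hx.convexCombination hx' hε.1.le hε.2).colSum_mem_Icc j
  have hstep {ε : ℝ} (hε : ε ∈ Set.Ioc (0 : ℝ) 1) :
      ∑ j, w j * ((1 - f j (a j + ε * (b j - a j))) * (b j - a j)) ≤ 0 := by
    have hle := hopt _ (hx.convexCombination hx' hε.1.le hε.2)
    simp only [firstStageObj, hcol] at hle
    rw [← sub_nonpos, ← sum_sub_distrib] at hle
    refine nonpos_of_mul_nonpos_right (le_trans ?_ hle) hε.1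
    rw [mul_sum]
    refine sum_le_sum fun j _ => ?_
    have hint {c : ℝ} (hc : c ∈ Set.Icc (0 : ℝ) 1) {d : ℝ} (hd : d ∈ Set.Icc (0 : ℝ) 1) :
        IntervalIntegrable (f j) MeasureTheory.volume c d :=
      ((hf_mono j).mono (Set.ordConnected_Icc.uIcc_subset hc hd)).intervalIntegrable
    have hadd := intervalIntegral.integral_add_adjacent_intervals
      (hint ⟨le_rfl, zero_le_one⟩ (ha j)) (hint (ha j) (hmem hε j))
    have hub := integral_le_sub_mul_of_monotoneOn Set.ordConnected_Icc (hf_mono j) (ha j)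
      (hmem hε j)
    rw [← mul_sub, mul_left_comm]
    refine mul_le_mul_of_nonneg_left ?_ (hw j)
    change _ ≤ _ - (a j - ∫ t in (0 : ℝ)..a j, f j t)
    linarith
  have hlim : Filter.Tendsto
      (fun ε => ∑ j, w j * ((1 - f j (a j + ε * (b j - a j))) * (b j - a j)))
      (nhdsWithin 0 (Set.Ioc 0 1))
      (nhds (∑ j, w j * ((1 - f j (a j)) * (b j - a j)))) := by
    refine tendsto_finsetSum _ fun j _ => ((tendsto_const_nhds.sub ?_).mul_const _).const_mul _
    refine (hf_cont j (a j) (ha j)).tendsto.comp (tendsto_nhdsWithin_iff.2 ⟨?_, ?_⟩)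
    · refine Filter.Tendsto.mono_left (Continuous.tendsto' ?_ _ _ ?_) nhdsWithin_le_nhds
      · fun_prop
      · simp
    · filter_upwards [self_mem_nhdsWithin] with ε hε using hmem hε j
  have : (nhdsWithin (0 : ℝ) (Set.Ioc 0 1)).NeBot :=
    left_nhdsWithin_Ioc_neBot zero_lt_one
  refine le_of_tendsto hlim ?_
  filter_upwards [self_mem_nhdsWithin] with ε hε using hstep hε

end IsFracMatching

/-- Scaling down the columns of a fractional matching to the residual capacities yields a feasible
second-stage matching. -/
theorem exists_isSecondStageFeasible_colSum_eq_min {D₁ D₂ S : Type*} [Fintype D₁] [Fintype D₂]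
    [Fintype S] {E₂ : Finset (D₂ × S)} {x : D₁ → S → ℝ} (hx : ∀ j, ∑ i, x i j ≤ 1)
    {z : D₂ → S → ℝ} (hz : IsFracMatching E₂ z) :
    ∃ y, IsSecondStageFeasible E₂ x y ∧
      ∀ j, ∑ i, y i j = min (∑ i, z i j) (1 - ∑ i, x i j) := by
  set r : S → ℝ := fun j => min (∑ i, z i j) (1 - ∑ i, x i j) / ∑ i, z i j
  have hr0 (j : S) : 0 ≤ r j :=
    div_nonneg (le_min (hz.colSum_mem_Icc j).1 (sub_nonneg.2 (hx j))) (hz.colSum_mem_Icc j).1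
  have hr1 (j : S) : r j ≤ 1 := div_le_one_of_le₀ (min_le_left _ _) (hz.colSum_mem_Icc j).1
  have hcol (j : S) : ∑ i, z i j * r j = min (∑ i, z i j) (1 - ∑ i, x i j) := by
    rw [← sum_mul]
    refine mul_div_cancel_of_imp' fun h => ?_
    rw [h]
    exact min_eq_left (sub_nonneg.2 (hx j))
  refine ⟨fun i j => z i j * r j, ⟨fun i j => mul_nonneg (hz.1 i j) (hr0 j), fun i j hij => ?_,
    fun i => ?_, fun j => (hcol j).trans_le (min_le_right _ _)⟩, hcol⟩
  · simp [hz.2.1 i j hij]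
  · exact (sum_le_sum fun j _ => mul_le_of_le_one_right (hz.1 i j) (hr1 j)).trans (hz.2.2.1 i)

/-- The pointwise inequality behind robustness: `a` is the first-stage fill level, `p` the penalty
at that level, and `u`, `v` are the amounts matched offline in the two stages. -/
theorem mul_add_le_of_envelope {R a p u v : ℝ}
    (ha : a ∈ Set.Icc (0 : ℝ) 1) (hp : p ∈ Set.Icc (0 : ℝ) 1)
    (hlb : a - (1 - R) ≤ a * p) (hub : p * (1 - a) ≤ 1 - R)
    (hu : 0 ≤ u) (hv : 0 ≤ v) (huv : u + v ≤ 1) :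
    R * (u + v) ≤ a + min v (1 - a) + (1 - p) * (u - a) := by
  obtain ⟨ha0, ha1⟩ := ha
  obtain ⟨hp0, hp1⟩ := hp
  have hmin : v * (1 - a) ≤ min v (1 - a) :=
    le_min (by nlinarith) (by nlinarith)
  have := mul_nonneg hu (sub_nonneg.2 hub)
  have := mul_nonneg hv (sub_nonneg.2 hlb)
  have := mul_nonneg (mul_nonneg ha0 hp0) (sub_nonneg.2 huv)
  linarith

/-- Robustness theorem (Theorem 4.1): if each penalty function
`f_j : [0,1] → [0,1]` is continuous, nondecreasing, and lies in the envelope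
`1 − (1−R)/x ≤ f_j(x) ≤ (1−R)/(1−x)`, then the two-stage algorithm that first
maximizes `Σ_j w_j (x_j − ∫₀^{x_j} f_j)` and then matches optimally achieves
value at least `R` times the optimal offline matching value. -/
theorem robustness_theorem
    {D₁ D₂ S : Type*} [Fintype D₁] [Fintype D₂] [Fintype S]
    (E₁ : Finset (D₁ × S)) (E₂ : Finset (D₂ × S))
    (w : S → ℝ) (hw : ∀ j, 0 ≤ w j)
    (R : ℝ) (hR0 : 0 ≤ R) (hR1 : R ≤ 3 / 4)
    (f : S → ℝ → ℝ)
    (hf_cont : ∀ j, ContinuousOn (f j) (Set.Icc 0 1))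
    (hf_mono : ∀ j, MonotoneOn (f j) (Set.Icc 0 1))
    (hf_range : ∀ j, ∀ t ∈ Set.Icc (0:ℝ) 1, f j t ∈ Set.Icc (0:ℝ) 1)
    (hf_lb : ∀ j, ∀ x ∈ Set.Ioc (0:ℝ) 1, 1 - (1 - R) / x ≤ f j x)
    (hf_ub : ∀ j, ∀ x ∈ Set.Ico (0:ℝ) 1, f j x ≤ (1 - R) / (1 - x))
    (xbar : D₁ → S → ℝ)
    (hxbar : IsFracMatching E₁ xbar)
    (hxopt : ∀ x : D₁ → S → ℝ, IsFracMatching E₁ x →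
      firstStageObj w f x ≤ firstStageObj w f xbar)
    (ybar : D₂ → S → ℝ)
    (hybar : IsSecondStageFeasible E₂ xbar ybar)
    (hyopt : ∀ y : D₂ → S → ℝ, IsSecondStageFeasible E₂ xbar y →
      ∑ j, w j * ∑ i, y i j ≤ ∑ j, w j * ∑ i, ybar i j) :
    ∑ j, w j * ((∑ i, xbar i j) + (∑ i, ybar i j)) ≥
      R * sSup (offlineValues E₁ E₂ w) := by
  have ha := hxbar.colSum_mem_Icc
  have hVnonneg : 0 ≤ ∑ j, w j * ((∑ i, xbar i j) + (∑ i, ybar i j)) :=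
    sum_nonneg fun j _ => mul_nonneg (hw j)
      (add_nonneg (ha j).1 (sum_nonneg fun i _ => hybar.1 i j))
  have hbound : ∀ v ∈ offlineValues E₁ E₂ w,
      R * v ≤ ∑ j, w j * ((∑ i, xbar i j) + (∑ i, ybar i j)) := by
    rintro _ ⟨z, hz0, hzE₁, hzE₂, hzrow, hzcol, rfl⟩
    simp only [Fintype.sum_sum_type] at hzcol ⊢
    have hz₁0 (j : S) : 0 ≤ ∑ i, z (Sum.inl i) j := sum_nonneg fun i _ => hz0 _ j
    have hz₂0 (j : S) : 0 ≤ ∑ i, z (Sum.inr i) j := sum_nonneg fun i _ => hz0 _ j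
    have hz₁ : IsFracMatching E₁ fun i => z (Sum.inl i) :=
      ⟨fun i => hz0 _, hzE₁, fun i => hzrow _, fun j => by linarith [hzcol j, hz₂0 j]⟩
    have hz₂ : IsFracMatching E₂ fun i => z (Sum.inr i) :=
      ⟨fun i => hz0 _, hzE₂, fun i => hzrow _, fun j => by linarith [hzcol j, hz₁0 j]⟩
    have hfirst := hxbar.sum_gradient_mul_sub_nonpos hw hf_cont hf_mono hxopt hz₁
    obtain ⟨y, hy, hycol⟩ := exists_isSecondStageFeasible_colSum_eq_min hxbar.2.2.2 hz₂
    have hsecond := hyopt y hy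
    have hpoint : ∑ j, w j * (R * (∑ i, z (Sum.inl i) j + ∑ i, z (Sum.inr i) j)) ≤
        ∑ j, w j * (∑ i, xbar i j + ∑ i, y i j +
          (1 - f j (∑ i, xbar i j)) * (∑ i, z (Sum.inl i) j - ∑ i, xbar i j)) := by
      refine sum_le_sum fun j _ => mul_le_mul_of_nonneg_left ?_ (hw j)
      rw [hycol j]
      refine mul_add_le_of_envelope (ha j) (hf_range j _ (ha j)) ?_ ?_
        (hz₁0 j) (hz₂0 j) (hzcol j)
      · rcases (ha j).1.eq_or_lt with h | h
        · rw [← h]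
          linarith
        · have := mul_le_mul_of_nonneg_left (hf_lb j _ ⟨h, (ha j).2⟩) h.le
          rwa [mul_sub, mul_one, mul_div_cancel₀ _ h.ne'] at this
      · rcases (ha j).2.eq_or_lt with h | h
        · rw [h]
          linarith
        · exact (le_div_iff₀ (sub_pos.2 h)).1 (hf_ub j _ ⟨(ha j).1, h⟩)
    simp only [mul_add, sum_add_distrib, mul_left_comm _ R, ← mul_sum] at hpoint hfirst ⊢
    linarith
  rcases hR0.eq_or_lt with rfl | hR
  · simpa using hVnonneg
  · rw [ge_iff_le, ← le_div_iff₀' hR]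
    exact Real.sSup_le (fun v hv => (le_div_iff₀' hR).2 (hbound v hv))
      (div_nonneg hVnonneg hR.le)
end

section
/- Consistency theorem (Theorem 5.1): Let D₁, D₂, S be finite sets, E₁ ⊆ D₁ × S, E₂ ⊆ D₂ × S, w : S → ℝ with w_j ≥ 0, and let R ∈ [0, 3/4]. Let A ⊆ E₁ be a matching (no two edges of A share a vertex of D₁ or of S), and let S₁ = { j ∈ S : (i,j) ∈ A for some i }. For j ∈ S₁ set f_j(x) = max{0, 1 − (1−R)/x} (with f_j(0) = 0), and for j ∈ S ∖ S₁ set f_j(x) = min{1, (1−R)/(1−x)} (with f_j(1) = 1). Let x̄ maximize Σ_{j∈S} w_j ( x_j − ∫₀^{x_j} f_j(t) dt ) over all first-stage fractional matchings x on (D₁, S, E₁), and let ȳ maximize Σ_{j∈S} w_j y_j over all y : D₂ × S → ℝ with y ≥ 0, supported on E₂, Σ_j y_{ij} ≤ 1 for every i ∈ D₂, and Σ_i y_{ij} ≤ 1 − x̄_j for every j ∈ S. Let ADVICE = Σ_{j∈S₁} w_j + V, where V is the supremum of Σ_{j∈S} w_j y_j over all y : D₂ × S → ℝ with y ≥ 0,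 supported on E₂, Σ_j y_{ij} ≤ 1 for every i ∈ D₂, Σ_i y_{ij} ≤ 1 for j ∉ S₁, and Σ_i y_{ij} = 0 for j ∈ S₁. Then Σ_{j∈S} w_j (x̄_j + ȳ_j) ≥ (2√(1−R) − (1−R)) · ADVICE. -/
open Finset

/-- The set of second-stage values attainable when the offline vertices in `S₁`
(those matched by the advice in the first stage) are fully used, and all other
offline vertices are fully free; its supremum is the second-stage value `V` of
the advice. -/
def adviceSecondStageValues {D₂ S : Type*} [Fintype D₂] [Fintype S]
    (E₂ : Finset (D₂ × S)) (S₁ : Finset S) (w : S → ℝ) : Set ℝ :=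
  {v | ∃ y : D₂ → S → ℝ,
    (∀ i j, 0 ≤ y i j) ∧ (∀ i j, (i, j) ∉ E₂ → y i j = 0) ∧
    (∀ i, ∑ j, y i j ≤ 1) ∧
    (∀ j ∉ S₁, ∑ i, y i j ≤ 1) ∧ (∀ j ∈ S₁, ∑ i, y i j = 0) ∧
    v = ∑ j, w j * ∑ i, y i j}

/-- If `G` has derivative `d` at `0` and `G ≤ G 0` on `(0, 1]`, then `d ≤ 0`. -/
lemma HasDerivAt.nonpos_of_le_right {G : ℝ → ℝ} {d : ℝ} (hG : HasDerivAt G d 0)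
    (h : ∀ ε : ℝ, 0 < ε → ε ≤ 1 → G ε ≤ G 0) : d ≤ 0 := by
  refine le_of_tendsto hG.tendsto_slope_zero_right ?_
  filter_upwards [Ioc_mem_nhdsGT (zero_lt_one' ℝ)] with ε hε
  have := h ε hε.1 hε.2
  simp only [zero_add, smul_eq_mul]
  exact mul_nonpos_of_nonneg_of_nonpos (inv_nonneg.2 hε.1.le) (by linarith)

/-- Fractional matchings are closed under convex combinations. -/
lemma IsFracMatching.convex_comb {D S : Type*} [Fintype D] [Fintype S]
    {E : Finset (D × S)} {x z : D → S → ℝ} (hx : IsFracMatching E x)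
    (hz : IsFracMatching E z) {ε : ℝ} (h0 : 0 ≤ ε) (h1 : ε ≤ 1) :
    IsFracMatching E (fun i j => (1 - ε) * x i j + ε * z i j) := by
  obtain ⟨hx0, hxs, hxr, hxc⟩ := hx
  obtain ⟨hz0, hzs, hzr, hzc⟩ := hz
  have h1' : 0 ≤ 1 - ε := by linarith
  refine ⟨fun i j => ?_, fun i j hij => ?_, fun i => ?_, fun j => ?_⟩
  · exact add_nonneg (mul_nonneg h1' (hx0 i j)) (mul_nonneg h0 (hz0 i j))
  · simp [hxs i j hij, hzs i j hij]
  · rw [sum_add_distrib, ← mul_sum, ← mul_sum]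
    nlinarith [hxr i, hzr i]
  · rw [sum_add_distrib, ← mul_sum, ← mul_sum]
    nlinarith [hxc j, hzc j]

/-- First-order optimality condition for the first-stage objective, when the penalties agree on
`[0, 1]` with continuous functions `g j`. -/
lemma IsFracMatching.first_order {D S : Type*} [Fintype D] [Fintype S]
    {E : Finset (D × S)} {w : S → ℝ} {f g : S → ℝ → ℝ}
    (hg : ∀ j, Continuous (g j)) (hfg : ∀ j, ∀ t ∈ Set.Icc (0 : ℝ) 1, f j t = g j t)
    {x z : D → S → ℝ} (hx : IsFracMatching E x) (hz : IsFracMatching E z)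
    (hopt : ∀ u : D → S → ℝ, IsFracMatching E u → firstStageObj w f u ≤ firstStageObj w f x) :
    ∑ j, w j * ((1 - g j (∑ i, x i j)) * ((∑ i, z i j) - ∑ i, x i j)) ≤ 0 := by
  have hobj : ∀ u : D → S → ℝ, IsFracMatching E u → firstStageObj w f u =
      ∑ j, w j * ((∑ i, u i j) - ∫ t in (0 : ℝ)..(∑ i, u i j), g j t) := by
    intro u hu
    refine sum_congr rfl fun j _ => ?_
    congr 2
    refine intervalIntegral.integral_congr fun t ht => hfg j t ?_
    rw [Set.uIcc_of_le (sum_nonneg fun i _ => hu.1 i j)] at ht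
    exact ⟨ht.1, ht.2.trans (hu.2.2.2 j)⟩
  set p : S → ℝ → ℝ := fun j ε => (∑ i, x i j) + ε * ((∑ i, z i j) - ∑ i, x i j) with hp
  have hp0 : ∀ j, p j 0 = ∑ i, x i j := fun j => by simp [hp]
  have hpd : ∀ j, HasDerivAt (p j) ((∑ i, z i j) - ∑ i, x i j) 0 := fun j => by
    simpa only [id, one_mul] using
      ((hasDerivAt_id (0 : ℝ)).mul_const ((∑ i, z i j) - ∑ i, x i j)).const_add (∑ i, x i j)
  refine HasDerivAt.nonpos_of_le_right
    (G := fun ε => ∑ j, w j * (p j ε - ∫ t in (0 : ℝ)..(p j ε), g j t)) ?_ ?_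
  · refine HasDerivAt.fun_sum fun j _ => HasDerivAt.const_mul _ ?_
    have hint : HasDerivAt (fun a => ∫ t in (0 : ℝ)..a, g j t) (g j (p j 0)) (p j 0) :=
      intervalIntegral.integral_hasDerivAt_right ((hg j).intervalIntegrable _ _)
        ((hg j).stronglyMeasurableAtFilter _ _) (hg j).continuousAt
    have := (hpd j).sub (hint.comp 0 (hpd j))
    rw [hp0] at this
    exact this.congr_deriv (by ring)
  · intro ε h0 h1
    have hu := hx.convex_comb hz h0.le h1
    have hle := hopt _ hu
    rw [hobj _ hu, hobj _ hx] at hle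
    have hcol : ∀ j, ∑ i, ((1 - ε) * x i j + ε * z i j) = p j ε := fun j => by
      rw [sum_add_distrib, ← mul_sum, ← mul_sum]
      simp only [hp]
      ring
    simpa only [hcol, hp0] using hle

/-- A continuous form of `max 0 (1 - r / x)` on the nonnegative reals. -/
lemma lower_penalty_eq {r x : ℝ} (hr : 0 < r) (hx : 0 ≤ x) :
    (if x = 0 then 0 else max 0 (1 - r / x)) = 1 - r / max x r := by
  rcases hx.eq_or_lt with rfl | hx
  · simp [hr.le, hr.ne']
  rw [if_neg hx.ne']
  rcases le_total x r with h | h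
  · rw [max_eq_right h, div_self hr.ne', max_eq_left]
    · ring
    · have := (one_le_div hx).2 h
      linarith
  · rw [max_eq_left h, max_eq_right]
    have := (div_le_one hx).2 h
    linarith

/-- A continuous form of `min 1 (r / (1 - x))` on `(-∞, 1]`. -/
lemma upper_penalty_eq {r x : ℝ} (hr : 0 < r) (hx : x ≤ 1) :
    (if x = 1 then 1 else min 1 (r / (1 - x))) = r / max (1 - x) r := by
  rcases hx.eq_or_lt with rfl | hx
  · simp [hr.le, hr.ne']
  rw [if_neg hx.ne]
  have hx' : 0 < 1 - x := by linarith
  rcases le_total (1 - x) r with h | h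
  · rw [max_eq_right h, div_self hr.ne', min_eq_left ((one_le_div hx').2 h)]
  · rw [max_eq_left h, min_eq_right ((div_le_one hx').2 h)]

lemma two_mul_sqrt_le_add_div {r x : ℝ} (hr : 0 ≤ r) (hx : 0 < x) :
    2 * √r ≤ x + r / x := by
  have h : x + r / x - 2 * √r = (x - √r) ^ 2 / x := by
    field_simp
    linear_combination -Real.sq_sqrt hr
  have : 0 ≤ (x - √r) ^ 2 / x := by positivity
  linarith

lemma two_mul_sqrt_sub_le_one {r : ℝ} (hr : 0 ≤ r) : 2 * √r - r ≤ 1 := by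
  nlinarith [sq_nonneg (√r - 1), Real.sq_sqrt hr]

/-- Bound at an offline vertex matched by the advice. -/
lemma lower_penalty_bound {r x : ℝ} (hr : 0 < r) :
    2 * √r - r ≤ x + (1 - (1 - r / max x r)) * (1 - x) := by
  rcases le_total x r with h | h
  · rw [max_eq_right h, div_self hr.ne']
    linarith [two_mul_sqrt_sub_le_one hr.le]
  · have hx : 0 < x := hr.trans_le h
    rw [max_eq_left h]
    have := two_mul_sqrt_le_add_div hr.le hx
    have h2 : r / x * x = r := div_mul_cancel₀ r hx.ne'
    linarith

/-- Bound at an offline vertex not matched by the advice. -/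
lemma upper_penalty_bound {r x y : ℝ} (hr : 0 < r) (hx : 0 ≤ x) (hy0 : 0 ≤ y) (hy1 : y ≤ 1) :
    (2 * √r - r) * y ≤ x + y * (1 - x) - (1 - r / max (1 - x) r) * x := by
  have hpos : 0 < max (1 - x) r := lt_max_of_lt_right hr
  have key : 2 * √r - r ≤ 1 - x + r / max (1 - x) r * x := by
    rcases le_total (1 - x) r with h | h
    · rw [max_eq_right h, div_self hr.ne']
      linarith [two_mul_sqrt_sub_le_one hr.le]
    · have hx' : 0 < 1 - x := hr.trans_le h
      rw [max_eq_left h]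
      have := two_mul_sqrt_le_add_div hr.le hx'
      have h2 : r / (1 - x) * (1 - x) = r := div_mul_cancel₀ r hx'.ne'
      linarith
  have hfx : 0 ≤ r / max (1 - x) r * x := by positivity
  nlinarith [mul_le_mul_of_nonneg_right key hy0, mul_nonneg hfx (sub_nonneg.2 hy1)]

open scoped Classical in
/-- The indicator of a matching is a fractional matching. -/
lemma isFracMatching_indicator {D S : Type*} [Fintype D] [Fintype S]
    {E A : Finset (D × S)} (hA : A ⊆ E)
    (hm : ∀ e ∈ A, ∀ e' ∈ A, e ≠ e' → e.1 ≠ e'.1 ∧ e.2 ≠ e'.2) :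
    IsFracMatching E (fun i j => if (i, j) ∈ A then 1 else 0) := by
  refine ⟨fun i j => by dsimp only; split_ifs <;> norm_num, fun i j hij => if_neg fun h => hij (hA h),
    fun i => ?_, fun j => ?_⟩
  · rw [sum_boole]
    norm_cast
    refine card_le_one.2 fun a ha b hb => by_contra fun hab => ?_
    simp only [mem_filter, mem_univ, true_and] at ha hb
    exact (hm _ ha _ hb (by simpa using hab)).1 rfl
  · rw [sum_boole]
    norm_cast
    refine card_le_one.2 fun a ha b hb => by_contra fun hab => ?_
    simp only [mem_filter, mem_univ, true_and] at ha hb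
    exact (hm _ ha _ hb (by simpa using hab)).2 rfl

/-- Scaling a second-stage matching by the free capacities makes it feasible. -/
lemma IsFracMatching.scale_second_stage {D₁ D₂ S : Type*} [Fintype D₁] [Fintype D₂] [Fintype S]
    {E₁ : Finset (D₁ × S)} {E₂ : Finset (D₂ × S)} {x : D₁ → S → ℝ} {y : D₂ → S → ℝ}
    (hx : IsFracMatching E₁ x) (hy : IsFracMatching E₂ y) :
    IsSecondStageFeasible E₂ x (fun i j => y i j * (1 - ∑ k, x k j)) := by
  obtain ⟨hx0, -, -, hxc⟩ := hx
  obtain ⟨hy0, hys, hyr, hyc⟩ := hy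
  refine ⟨fun i j => mul_nonneg (hy0 i j) (sub_nonneg.2 (hxc j)),
    fun i j hij => by simp [hys i j hij], fun i => ?_, fun j => ?_⟩
  · refine (sum_le_sum fun j _ => ?_).trans (hyr i)
    exact mul_le_of_le_one_right (hy0 i j)
      (sub_le_self _ (sum_nonneg fun k _ => hx0 k j))
  · rw [← sum_mul]
    exact mul_le_of_le_one_left (sub_nonneg.2 (hxc j)) (hyc j)

/-- Consistency theorem (Theorem 5.1): running the two-stage algorithm with the
lower penalty function `f_L(x) = max{0, 1 − (1−R)/x}` on the offline vertices
`S₁` suggested by the advice matching `A`, and the upper penalty function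
`f_U(x) = min{1, (1−R)/(1−x)}` on the rest, achieves value at least
`(2√(1−R) − (1−R))` times `ADVICE = Σ_{j∈S₁} w_j + V`. -/
theorem consistency_theorem
    {D₁ D₂ S : Type*} [Fintype D₁] [Fintype D₂] [Fintype S]
    (E₁ : Finset (D₁ × S)) (E₂ : Finset (D₂ × S))
    (w : S → ℝ) (hw : ∀ j, 0 ≤ w j)
    (R : ℝ) (hR0 : 0 ≤ R) (hR1 : R ≤ 3 / 4)
    (A : Finset (D₁ × S)) (hA : A ⊆ E₁)
    (hA_match : ∀ e ∈ A, ∀ e' ∈ A, e ≠ e' → e.1 ≠ e'.1 ∧ e.2 ≠ e'.2)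
    (S₁ : Finset S) (hS₁ : ∀ j : S, j ∈ S₁ ↔ ∃ i : D₁, (i, j) ∈ A)
    (f : S → ℝ → ℝ)
    (hf_in : ∀ j ∈ S₁, ∀ x : ℝ,
      f j x = if x = 0 then 0 else max 0 (1 - (1 - R) / x))
    (hf_out : ∀ j ∉ S₁, ∀ x : ℝ,
      f j x = if x = 1 then 1 else min 1 ((1 - R) / (1 - x)))
    (xbar : D₁ → S → ℝ)
    (hxbar : IsFracMatching E₁ xbar)
    (hxopt : ∀ x : D₁ → S → ℝ, IsFracMatching E₁ x →
      firstStageObj w f x ≤ firstStageObj w f xbar)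
    (ybar : D₂ → S → ℝ)
    (hybar : IsSecondStageFeasible E₂ xbar ybar)
    (hyopt : ∀ y : D₂ → S → ℝ, IsSecondStageFeasible E₂ xbar y →
      ∑ j, w j * ∑ i, y i j ≤ ∑ j, w j * ∑ i, ybar i j)
    (ADVICE : ℝ)
    (hADVICE : ADVICE = ∑ j ∈ S₁, w j + sSup (adviceSecondStageValues E₂ S₁ w)) :
    ∑ j, w j * ((∑ i, xbar i j) + (∑ i, ybar i j)) ≥
      (2 * Real.sqrt (1 - R) - (1 - R)) * ADVICE := by
  classical
  have hr : 0 < 1 - R := by linarith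
  set r := 1 - R with hr_def
  set c := 2 * √r - r with hc_def
  have hc : 0 < c := by
    have h1 : √r ≤ 1 := Real.sqrt_le_one.2 (by linarith)
    have h2 : 0 < √r := Real.sqrt_pos.2 hr
    nlinarith [Real.sq_sqrt hr.le]
  set g : S → ℝ → ℝ := fun j t => if j ∈ S₁ then 1 - r / max t r else r / max (1 - t) r with hg_def
  have hg : ∀ j, Continuous (g j) := by
    intro j
    by_cases hj : j ∈ S₁
    · simp only [hg_def, if_pos hj]
      exact continuous_const.sub (continuous_const.div (by fun_prop)
        fun t => (lt_max_of_lt_right hr).ne')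
    · simp only [hg_def, if_neg hj]
      exact continuous_const.div (by fun_prop) fun t => (lt_max_of_lt_right hr).ne'
  have hfg : ∀ j, ∀ t ∈ Set.Icc (0 : ℝ) 1, f j t = g j t := by
    intro j t ht
    by_cases hj : j ∈ S₁
    · simp only [hg_def, if_pos hj]
      rw [hf_in j hj, lower_penalty_eq hr ht.1]
    · simp only [hg_def, if_neg hj]
      rw [hf_out j hj, upper_penalty_eq hr ht.2]
  have hAm := isFracMatching_indicator hA hA_match
  have hAcol : ∀ j, ∑ i, (if (i, j) ∈ A then (1 : ℝ) else 0) = if j ∈ S₁ then 1 else 0 := by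
    intro j
    by_cases hj : j ∈ S₁
    · rw [if_pos hj]
      obtain ⟨i, hi⟩ := (hS₁ j).1 hj
      refine le_antisymm (hAm.2.2.2 j) ?_
      have := single_le_sum (fun k _ => hAm.1 k j) (mem_univ i)
      simpa [hi] using this
    · rw [if_neg hj]
      exact sum_eq_zero fun i _ => if_neg fun h => hj ((hS₁ j).2 ⟨i, h⟩)
  have hfirst := IsFracMatching.first_order hg hfg hxbar hAm hxopt
  simp only [hAcol] at hfirst
  have hV : sSup (adviceSecondStageValues E₂ S₁ w) ≤
      (∑ j, w j * ((∑ i, xbar i j) + (∑ i, ybar i j))) / c - ∑ j ∈ S₁, w j := by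
    refine csSup_le ⟨0, fun _ _ => 0, by simp⟩ ?_
    rintro v ⟨y, hy0, hys, hyr, hyout, hyin, rfl⟩
    have hyc : ∀ j, ∑ i, y i j ≤ 1 := fun j => by
      by_cases hj : j ∈ S₁
      · simp [hyin j hj]
      · exact hyout j hj
    have hsecond := hyopt _ (hxbar.scale_second_stage ⟨hy0, hys, hyr, hyc⟩)
    simp only [← sum_mul] at hsecond
    have hvertex : ∀ j, w j * (c * ((if j ∈ S₁ then 1 else 0) + ∑ i, y i j)) ≤
        w j * (∑ i, xbar i j) + w j * ((∑ i, y i j) * (1 - ∑ i, xbar i j)) +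
          w j * ((1 - g j (∑ i, xbar i j)) * ((if j ∈ S₁ then 1 else 0) - ∑ i, xbar i j)) := by
      intro j
      rw [← mul_add, ← mul_add]
      refine mul_le_mul_of_nonneg_left ?_ (hw j)
      by_cases hj : j ∈ S₁
      · simp only [hg_def, if_pos hj, hyin j hj]
        linarith [lower_penalty_bound (x := ∑ i, xbar i j) hr]
      · simp only [hg_def, if_neg hj]
        linarith [upper_penalty_bound hr (sum_nonneg fun i (_ : i ∈ univ) => hxbar.1 i j)
          (sum_nonneg fun i (_ : i ∈ univ) => hy0 i j) (hyc j)]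
    have htotal := sum_le_sum fun j (_ : j ∈ univ) => hvertex j
    have hadvice : ∑ j, w j * (c * ((if j ∈ S₁ then 1 else 0) + ∑ i, y i j)) =
        (∑ j ∈ S₁, w j + ∑ j, w j * ∑ i, y i j) * c := by
      have : ∑ j ∈ S₁, w j = ∑ j, w j * (if j ∈ S₁ then 1 else 0) := by simp
      rw [this, ← sum_add_distrib, sum_mul]
      exact sum_congr rfl fun j _ => by ring
    rw [hadvice, sum_add_distrib, sum_add_distrib] at htotal
    rw [le_sub_iff_add_le', le_div_iff₀ hc]
    simp only [mul_add, sum_add_distrib]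
    linarith
  rw [le_sub_iff_add_le', ← hADVICE, le_div_iff₀ hc] at hV
  linarith
end

section
/- Tightness of the robustness–consistency tradeoff (Theorem 6.1, instance-level form): Let R ∈ [0, 3/4] with R < 1, set w = 1/√(1−R) − 1, and let C ∈ ℝ and x ∈ [0,1]. If (w + 1 − x)/(1 + w) ≥ R and (w·x + 1)/(1 + w) ≥ C, then C ≤ 2√(1−R) − (1−R). -/
/-- Tightness of the robustness–consistency tradeoff (instance-level form):
with `w = 1/√(1−R) − 1`, if the first-stage decision `x ∈ [0,1]` satisfies the
`R`-robustness constraint `(w + 1 − x)/(1 + w) ≥ R` and the `C`-consistency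
constraint `(w·x + 1)/(1 + w) ≥ C`, then `C ≤ 2√(1−R) − (1−R)`. -/
theorem two_stage_matching_tradeoff_tight
    (R C x : ℝ) (hR0 : 0 ≤ R) (hR1 : R ≤ 3 / 4) (hRlt : R < 1)
    (hx0 : 0 ≤ x) (hx1 : x ≤ 1)
    (w : ℝ) (hw : w = 1 / Real.sqrt (1 - R) - 1)
    (hrob : (w + 1 - x) / (1 + w) ≥ R)
    (hcons : (w * x + 1) / (1 + w) ≥ C) :
    C ≤ 2 * Real.sqrt (1 - R) - (1 - R) := by
  obtain ⟨s, hs⟩ : ∃ s, s = Real.sqrt (1 - R) := ⟨_, rfl⟩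
  have hs_pos : 0 < s := hs ▸ Real.sqrt_pos.mpr (by linarith)
  have hs_sq : s ^ 2 = 1 - R := by rw [hs, Real.sq_sqrt (by linarith)]
  have hs_le : s ≤ 1 := by nlinarith
  rw [← hs] at hw ⊢
  have hrob_eq : (w + 1 - x) / (1 + w) = 1 - x * s := by
    rw [hw]
    field_simp
    ring
  have hcons_eq : (w * x + 1) / (1 + w) = (1 - s) * x + s := by
    rw [hw]
    field_simp
    ring
  rw [hrob_eq] at hrob
  rw [hcons_eq] at hcons
  have hxs : x ≤ s := le_of_mul_le_mul_right (by linarith : x * s ≤ s * s) hs_pos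
  linarith [mul_le_mul_of_nonneg_left hxs (sub_nonneg.mpr hs_le)]
end

section
/- Core minimization inequality for consistency (combining Cases 2a–2c of Claim 5.1): Let R ∈ (0, 3/4], μ = 1/(1−R), and λ = 1/(1 − √(1−R))². Then for all reals z₀, z₁, z₂ ≥ 0 with z₀ + z₁ + z₂ = 1 and z₁ > 0, we have (μ z₁² + z₀ + λ z₂)/(μ z₁ + λ z₂) ≥ 2√(1−R) − (1−R). -/
/-- Core minimization inequality for consistency: with `μ = 1/(1−R)` and
`λ = 1/(1 − √(1−R))²`, for all `z₀, z₁, z₂ ≥ 0` with `z₀ + z₁ + z₂ = 1` and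
`z₁ > 0`, we have `(μ z₁² + z₀ + λ z₂)/(μ z₁ + λ z₂) ≥ 2√(1−R) − (1−R)`. -/
theorem core_consistency_minimization
    (R : ℝ) (hR0 : 0 < R) (hR1 : R ≤ 3 / 4)
    (μ lam : ℝ) (hμ : μ = 1 / (1 - R)) (hlam : lam = 1 / (1 - Real.sqrt (1 - R)) ^ 2)
    (z₀ z₁ z₂ : ℝ) (h0 : 0 ≤ z₀) (h1 : 0 < z₁) (h2 : 0 ≤ z₂)
    (hsum : z₀ + z₁ + z₂ = 1) :
    (μ * z₁ ^ 2 + z₀ + lam * z₂) / (μ * z₁ + lam * z₂) ≥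
      2 * Real.sqrt (1 - R) - (1 - R) := by
  have hs_sq : Real.sqrt (1 - R) ^ 2 = 1 - R := Real.sq_sqrt (by linarith)
  have hs_pos : 0 < Real.sqrt (1 - R) := Real.sqrt_pos.mpr (by linarith)
  have hs_lt : Real.sqrt (1 - R) < 1 := by nlinarith
  generalize Real.sqrt (1 - R) = s at *
  rw [← hs_sq] at hμ ⊢
  have hd : 0 < 1 - s := by linarith
  have hμ_pos : 0 < μ := by rw [hμ]; positivity
  have hlam_pos : 0 < lam := by rw [hlam]; positivity
  have hμs : μ * s ^ 2 = 1 := by rw [hμ]; field_simp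
  have hlams : lam * (1 - s) ^ 2 = 1 := by rw [hlam]; field_simp
  rw [ge_iff_le, le_div_iff₀ (by positivity)]
  have key : μ * z₁ ^ 2 + z₀ + lam * z₂ - (2 * s - s ^ 2) * (μ * z₁ + lam * z₂)
      = μ * (z₁ - s) ^ 2 := by
    linear_combination z₂ * hlams + hsum + (z₁ - 1) * hμs
  have hnonneg : 0 ≤ μ * (z₁ - s) ^ 2 := by positivity
  linarith
end

section
/- Claim B.3: For all reals R and z with 0 ≤ R ≤ 3/4 and 0 ≤ z < 1, z·(R − z)/(1 − z) ≤ 2 − R − 2√(1−R). -/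
/-- Claim B.3: for `0 ≤ R ≤ 3/4` and `0 ≤ z < 1`,
`z·(R − z)/(1 − z) ≤ 2 − R − 2√(1−R)`. -/
theorem claimB3 (R z : ℝ) (hR0 : 0 ≤ R) (hR1 : R ≤ 3 / 4) (hz0 : 0 ≤ z) (hz1 : z < 1) :
    z * (R - z) / (1 - z) ≤ 2 - R - 2 * Real.sqrt (1 - R) := by
  have hs : Real.sqrt (1 - R) ^ 2 = 1 - R := Real.sq_sqrt (by linarith)
  rw [div_le_iff₀ (sub_pos.mpr hz1)]
  linarith [sq_nonneg (1 - z - Real.sqrt (1 - R))]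
end

section
/- Claim B.5: Let μ, λ > 0 be reals with 1/√μ + 1/√λ = 1, and let z₀, z₁, z₂ ∈ ℝ with z₀ + z₁ + z₂ = 1 and μ z₁ + λ z₂ ≠ 0. If (μ z₁² − μ z₁ + z₀)/(μ z₁ + λ z₂) = −1/λ, then z₁ = 1/√μ. -/
/-- Claim B.5: if `μ, λ > 0` with `1/√μ + 1/√λ = 1`, `z₀ + z₁ + z₂ = 1`,
`μ z₁ + λ z₂ ≠ 0`, and `(μ z₁² − μ z₁ + z₀)/(μ z₁ + λ z₂) = −1/λ`,
then `z₁ = 1/√μ`. -/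
theorem claimB5 (μ lam : ℝ) (hμ : 0 < μ) (hlam : 0 < lam)
    (hroot : 1 / Real.sqrt μ + 1 / Real.sqrt lam = 1)
    (z₀ z₁ z₂ : ℝ) (hsum : z₀ + z₁ + z₂ = 1)
    (hden : μ * z₁ + lam * z₂ ≠ 0)
    (heq : (μ * z₁ ^ 2 - μ * z₁ + z₀) / (μ * z₁ + lam * z₂) = -(1 / lam)) :
    z₁ = 1 / Real.sqrt μ := by
  obtain ⟨a, ha, rfl⟩ : ∃ a : ℝ, 0 < a ∧ a ^ 2 = μ :=
    ⟨√μ, Real.sqrt_pos.2 hμ, Real.sq_sqrt hμ.le⟩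
  obtain ⟨b, hb, rfl⟩ : ∃ b : ℝ, 0 < b ∧ b ^ 2 = lam :=
    ⟨√lam, Real.sqrt_pos.2 hlam, Real.sq_sqrt hlam.le⟩
  rw [Real.sqrt_sq ha.le, Real.sqrt_sq hb.le] at hroot
  rw [Real.sqrt_sq ha.le]
  have hab : a = b * (a - 1) := by
    field_simp at hroot
    linarith
  have hlin : b ^ 2 * (a ^ 2 * z₁ ^ 2 - a ^ 2 * z₁ + z₀) = -(a ^ 2 * z₁ + b ^ 2 * z₂) := by
    rw [div_eq_iff hden] at heq
    rw [heq]
    field_simp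
  have hsq : (b * (a * z₁ - 1)) ^ 2 = 0 := by
    linear_combination hlin - b ^ 2 * hsum - z₁ * (a + b * (a - 1)) * hab
  have hz : a * z₁ - 1 = 0 :=
    (mul_eq_zero.1 (pow_eq_zero_iff two_ne_zero |>.1 hsq)).resolve_left hb.ne'
  rw [eq_div_iff ha.ne']
  linarith
end
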